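/- arXiv:1211.2131 — 3 statements merged into one kernel-verified Lean document; each statement's English description precedes it below -/
import Mathlib

section
/- Let A_1,…,A_m be real symmetric n×n matrices. Then x = 0 is the only solution of the system xᵀ A_i x = 0, i = 1,…,m, if and only if there exists a constant β > 0 such that for every μ ∈ (0, β], the set {x ∈ ℝⁿ : ‖x‖ = 1} coincides with the solution set of the equation G_μ(x) = 0, where G_μ(x) = ( |∑_{i=1}^m |xᵀ A_i x| − μ| − (∑_{i=1}^m |xᵀ A_i x| − μ), xᵀx − 1 ) ∈ ℝ². -/
open Matrix

theorem isCompact_setOf_dotProduct_self_eq_one (n : ℕ) :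
    IsCompact {x : Fin n → ℝ | x ⬝ᵥ x = 1} := by
  refine (isCompact_closedBall (0 : Fin n → ℝ) 1).of_isClosed_subset
    (isClosed_eq (by fun_prop) continuous_const) fun x hx => ?_
  rw [mem_closedBall_zero_iff, pi_norm_le_iff_of_nonneg zero_le_one]
  intro i
  rw [Real.norm_eq_abs, abs_le_one_iff_mul_self_le_one, ← show x ⬝ᵥ x = 1 from hx]
  exact Finset.single_le_sum (f := fun j => x j * x j)
    (fun j _ => mul_self_nonneg _) (Finset.mem_univ i)

theorem stmt_16 {n m : ℕ}
    (A : Fin m → Matrix (Fin n) (Fin n) ℝ) (hA : ∀ i, (A i).IsSymm) :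
    (∀ x : Fin n → ℝ, (∀ i, x ⬝ᵥ (A i) *ᵥ x = 0) → x = 0) ↔
      ∃ β : ℝ, 0 < β ∧ ∀ μ ∈ Set.Ioc (0 : ℝ) β,
        {x : Fin n → ℝ | x ⬝ᵥ x = 1} =
        {x : Fin n → ℝ |
          |(∑ i, |x ⬝ᵥ (A i) *ᵥ x|) - μ| - ((∑ i, |x ⬝ᵥ (A i) *ᵥ x|) - μ) = 0 ∧
          x ⬝ᵥ x - 1 = 0} := by
  constructor
  · intro h
    obtain ⟨β, hβ, hle⟩ : ∃ β : ℝ, 0 < β ∧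
        ∀ x : Fin n → ℝ, x ⬝ᵥ x = 1 → β ≤ ∑ i, |x ⬝ᵥ (A i) *ᵥ x| := by
      rcases Set.eq_empty_or_nonempty {x : Fin n → ℝ | x ⬝ᵥ x = 1} with he | hne
      · exact ⟨1, one_pos, fun x hx => (Set.eq_empty_iff_forall_notMem.mp he x hx).elim⟩
      · obtain ⟨y, hy, hmin⟩ := (isCompact_setOf_dotProduct_self_eq_one n).exists_isMinOn hne
          (f := fun x => ∑ i, |x ⬝ᵥ (A i) *ᵥ x|) (by fun_prop)
        refine ⟨_, ?_, fun x hx => hmin hx⟩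
        refine lt_of_le_of_ne (Finset.sum_nonneg fun i _ => abs_nonneg _) fun h0 => ?_
        have hy0 : y = 0 := h y fun i => abs_eq_zero.mp
          ((Finset.sum_eq_zero_iff_of_nonneg fun i _ => abs_nonneg _).mp h0.symm i
            (Finset.mem_univ i))
        simp [hy0] at hy
    refine ⟨β, hβ, fun μ hμ => Set.ext fun x => ⟨fun hx => ⟨?_, sub_eq_zero.mpr hx⟩,
      fun hx => sub_eq_zero.mp hx.2⟩⟩
    rw [abs_of_nonneg (sub_nonneg.mpr (hμ.2.trans (hle x hx))), sub_self]
  · rintro ⟨β, hβ, h⟩ x hx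
    by_contra hne
    have hpos : 0 < x ⬝ᵥ x :=
      lt_of_le_of_ne (Finset.sum_nonneg fun i _ => mul_self_nonneg _)
        fun h0 => hne (dotProduct_self_eq_zero.mp h0.symm)
    have hy : (√(x ⬝ᵥ x))⁻¹ • x ∈ {x : Fin n → ℝ | x ⬝ᵥ x = 1} := by
      rw [Set.mem_ofPred_eq, smul_dotProduct, dotProduct_smul, smul_eq_mul, smul_eq_mul,
        ← mul_assoc, ← mul_inv, Real.mul_self_sqrt hpos.le, inv_mul_cancel₀ hpos.ne']
    rw [h β ⟨hβ, le_rfl⟩] at hy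
    have hy1 := hy.1
    simp only [mulVec_smul, smul_dotProduct, dotProduct_smul, hx, smul_zero, abs_zero,
      Finset.sum_const_zero, zero_sub, abs_neg, abs_of_pos hβ] at hy1
    linarith
end

section
/- Let m ≤ n − 2 and let A_1,…,A_m be real symmetric n×n matrices. Let μ > 0 be a given constant and suppose there exists x* ∈ ℝⁿ with ‖x*‖ = 1 such that G_μ(x*) ≠ 0 (equivalently, ∑_{i=1}^m |(x*)ᵀ A_i x*| < μ). Then there exists a sequence {x^k} ⊂ ℝⁿ with ‖x^k‖ → ∞ as k → ∞ such that for each k there exists γ^k ∈ (0, ∞) satisfying: (x^k)ᵀ A_i x^k − (x*)ᵀ A_i x* = −γ^k x^k_i for i = 1,…,m; |∑_{i=1}^m |(x^k)ᵀ A_i x^k| − μ| − (∑_{i=1}^m |(x^k)ᵀ A_i x^k| − μ) = −γ^k x^k_{n−1}; and (x^k − x*)ᵀ(x^k − x*) = −γ^k x^k_n. -/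
open Matrix Filter

section Brouwer

open Metric MeasureTheory Polynomial
open scoped NNReal Topology

/-- `t ↦ det (1 + t • A)` is a polynomial of degree at most `finrank ℝ E`, so Lagrange interpolation
at more than `finrank ℝ E` nodes reproduces it. -/
lemma det_one_add_smul_eq_sum_basis {E : Type*} [NormedAddCommGroup E] [NormedSpace ℝ E]
    [FiniteDimensional ℝ E] (A : E →L[ℝ] E) (s : Finset ℝ)
    (hs : Module.finrank ℝ E < s.card) (t : ℝ) :
    (1 + t • A).det = ∑ a ∈ s, (Lagrange.basis s id a).eval t * (1 + a • A).det := by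
  let b := Module.finBasis ℝ E
  let M := LinearMap.toMatrix b b (A : E →ₗ[ℝ] E)
  let p : ℝ[X] := det ((X : ℝ[X]) • M.map C + (1 : Matrix _ _ ℝ).map C)
  have hp : ∀ r : ℝ, p.eval r = (1 + r • A).det := by
    intro r
    have h1 : (1 + r • A).det = (1 + r • M).det := by
      rw [ContinuousLinearMap.det, ← LinearMap.det_toMatrix b]
      congr 1
      simp [M, LinearMap.toMatrix_one]
    rw [h1]
    simp only [p]
    rw [← Polynomial.coe_evalRingHom, RingHom.map_det]
    congr 1
    ext i j
    by_cases hij : i = j <;> simp [hij] <;> ring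
  have hdeg : p.degree < s.card := by
    refine lt_of_le_of_lt Polynomial.degree_le_natDegree ?_
    have := Polynomial.natDegree_det_X_add_C_le M 1
    rw [Fintype.card_fin] at this
    exact_mod_cast this.trans_lt hs
  rw [← hp t, Lagrange.eq_interpolate (v := id) Function.injective_id.injOn hdeg,
    Lagrange.interpolate_apply, Polynomial.eval_finsetSum]
  refine Finset.sum_congr rfl fun a _ => ?_
  simp [hp, mul_comm]

/-- A small Lipschitz perturbation of the identity that vanishes on the unit sphere maps the closed
unit ball onto itself. -/
lemma closedBall_subset_image_add {E : Type*} [NormedAddCommGroup E] [NormedSpace ℝ E]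
    [CompleteSpace E] {g : E → E} {K : ℝ≥0} (hg : LipschitzOnWith K g (closedBall 0 1))
    (h0 : ∀ x, ‖x‖ = 1 → g x = 0) (hK : 2 * K < 1) :
    closedBall 0 1 ⊆ (fun x => x + g x) '' closedBall 0 1 := by
  classical
  let G : E → E := fun x => if ‖x‖ ≤ 1 then g x else 0
  have hmix : ∀ x y : E, ‖x‖ ≤ 1 → 1 < ‖y‖ → ‖g x‖ ≤ 2 * K * ‖x - y‖ := by
    intro x y hx hy
    let z := ‖y‖⁻¹ • y
    have hy0 : 0 < ‖y‖ := by linarith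
    have hz : ‖z‖ = 1 := by simp [z, norm_smul, hy0.ne']
    have h1 := hg.norm_sub_le (x := x) (y := z) (by simpa using hx) (by simp [hz])
    rw [h0 z hz, sub_zero] at h1
    have h2 : ‖y - z‖ = ‖y‖ - 1 := by
      have : y - z = (1 - ‖y‖⁻¹) • y := by simp [z, sub_smul]
      rw [this, norm_smul, Real.norm_of_nonneg (sub_nonneg.2 (inv_le_one_of_one_le₀ hy.le))]
      field_simp
    have h3 : ‖x - z‖ ≤ ‖x - y‖ + ‖y - z‖ := norm_sub_le_norm_sub_add_norm_sub _ _ _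
    have h4 : ‖y‖ - ‖x‖ ≤ ‖x - y‖ := by
      rw [norm_sub_rev]; exact norm_sub_norm_le _ _
    calc ‖g x‖ ≤ K * ‖x - z‖ := h1
      _ ≤ K * (2 * ‖x - y‖) := by gcongr; linarith
      _ = _ := by ring
  have hG : LipschitzWith (2 * K) G := by
    refine LipschitzWith.of_dist_le_mul fun x y => ?_
    simp only [dist_eq_norm, NNReal.coe_mul, NNReal.coe_ofNat]
    have hnn : 0 ≤ (K : ℝ) * ‖x - y‖ := by positivity
    by_cases hx : ‖x‖ ≤ 1 <;> by_cases hy : ‖y‖ ≤ 1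
    · have := hg.norm_sub_le (x := x) (y := y) (by simpa using hx) (by simpa using hy)
      simp only [G, hx, hy, if_true]
      linarith
    · simpa only [G, hx, hy, if_true, if_false, sub_zero] using hmix x y hx (not_le.1 hy)
    · simp only [G, hx, hy, if_true, if_false, zero_sub, norm_neg]
      rw [norm_sub_rev]
      exact hmix y x hy (not_le.1 hx)
    · simp only [G, hx, hy, if_false, sub_zero, norm_zero]
      linarith
  intro y hy
  have hc : ContractingWith (2 * K) (fun x => y - G x) :=
    ⟨hK, by simpa using (LipschitzWith.const y).sub hG⟩
  have hfix := hc.fixedPoint_isFixedPt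
  set x := hc.fixedPoint
  have hx : y - G x = x := hfix
  have hx1 : ‖x‖ ≤ 1 := by
    by_contra h
    simp only [G, h, if_false, sub_zero] at hx
    exact h (hx ▸ by simpa using hy)
  refine ⟨x, by simpa using hx1, ?_⟩
  simp only [G, hx1, if_true] at hx
  exact eq_sub_iff_add_eq.1 hx.symm

variable {E : Type*} [NormedAddCommGroup E] [InnerProductSpace ℝ E] [FiniteDimensional ℝ E]

omit [FiniteDimensional ℝ E] in
lemma exists_forall_norm_lt_det_one_add_pos :
    ∃ ε > 0, ∀ B : E →L[ℝ] E, ‖B‖ < ε → 0 < (1 + B).det := by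
  have hc : ContinuousAt (fun B : E →L[ℝ] E => (1 + B).det) 0 :=
    (ContinuousLinearMap.continuous_det.comp (continuous_const.add continuous_id)).continuousAt
  have h1 : (0 : ℝ) < (1 + (0 : E →L[ℝ] E)).det := by
    simp [ContinuousLinearMap.det]
  have := hc.eventually (lt_mem_nhds h1)
  obtain ⟨ε, hε, h⟩ := Metric.eventually_nhds_iff.1 this
  exact ⟨ε, hε, fun B hB => h (by simpa using hB)⟩

/-- There is no `C¹` retraction of the closed unit ball onto the unit sphere. -/
theorem not_exists_contDiff_retraction_sphere (r : E → E)
    (hr : ∀ x ∈ closedBall (0 : E) 1, ContDiffAt ℝ 1 r x)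
    (hr1 : ∀ x ∈ closedBall (0 : E) 1, ∀ᶠ y in 𝓝 x, ‖r y‖ = 1)
    (hid : ∀ x : E, ‖x‖ = 1 → r x = x) : False := by
  borelize E
  set B := closedBall (0 : E) 1
  let g : E → E := fun x => r x - x
  have hg : ∀ x ∈ B, ContDiffAt ℝ 1 g x := fun x hx => (hr x hx).sub contDiffAt_id
  have hBc : IsCompact B := isCompact_closedBall _ _
  have hg' : ContinuousOn (fderiv ℝ g) B := fun x hx =>
    ((hg x hx).continuousAt_fderiv one_ne_zero).continuousWithinAt
  have hgd : ∀ x ∈ B, DifferentiableAt ℝ g x := fun x hx =>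
    (hg x hx).differentiableAt one_ne_zero
  obtain ⟨K', hK'⟩ := hBc.exists_bound_of_continuousOn hg'
  obtain ⟨K, hK0, hK⟩ : ∃ K : ℝ≥0, 0 < K ∧ ∀ x ∈ B, ‖fderiv ℝ g x‖ ≤ K :=
    ⟨Real.toNNReal K' + 1, by positivity, fun x hx => (hK' x hx).trans <| by
      push_cast
      linarith [Real.le_coe_toNNReal K']⟩
  obtain ⟨ε, hε, hdet⟩ := exists_forall_norm_lt_det_one_add_pos (E := E)
  have hintegrable : ∀ t : ℝ, IntegrableOn (fun x => (1 + t • fderiv ℝ g x).det) B := fun t =>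
    (ContinuousLinearMap.continuous_det.comp_continuousOn
      (continuousOn_const.add (hg'.const_smul t))).integrableOn_compact hBc
  let V : ℝ := (volume : Measure E).real B
  have hsmall : ∀ t : ℝ, 0 < t → t ≤ 1 → t * K < ε → 2 * (t * K) < 1 →
      ∫ x in B, (1 + t • fderiv ℝ g x).det = V := by
    intro t ht ht1 htε htK
    have hlip : LipschitzOnWith (Real.toNNReal t * K) (fun x => t • g x) B := by
      refine (convex_closedBall _ _).lipschitzOnWith_of_nnnorm_fderiv_le
        (fun x hx => (hgd x hx).const_smul t) fun x hx => ?_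
      rw [← NNReal.coe_le_coe, coe_nnnorm, fderiv_fun_const_smul (hgd x hx), norm_smul]
      simp only [NNReal.coe_mul, Real.coe_toNNReal _ ht.le, Real.norm_of_nonneg ht.le]
      gcongr
      exact hK x hx
    have hL : 2 * (Real.toNNReal t * K) < 1 := by
      rw [← NNReal.coe_lt_coe]
      simpa [Real.coe_toNNReal _ ht.le] using htK
    have himage : (fun x => x + t • g x) '' B = B := by
      refine Set.Subset.antisymm ?_
        (closedBall_subset_image_add hlip (fun x hx => by simp [g, hid x hx]) hL)
      rintro _ ⟨x, hx, rfl⟩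
      have hrx : r x ∈ B := by
        have := (hr1 x hx).self_of_nhds
        simp [B, this]
      have := (convex_closedBall (0 : E) 1) hx hrx (sub_nonneg.2 ht1) ht.le (by ring)
      convert this using 1
      simp only [g, smul_sub, sub_smul, one_smul]
      abel
    have hinj : Set.InjOn (fun x => x + t • g x) B := by
      intro x hx y hy hxy
      have h1 := hlip.norm_sub_le hx hy
      have h2 : t • g x - t • g y = -(x - y) := by
        have : x + t • g x = y + t • g y := hxy
        rw [← sub_eq_zero] at this ⊢
        rw [← this]; abel
      rw [h2, norm_neg] at h1
      have h3 : (Real.toNNReal t * K : ℝ) < 1 := by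
        rw [Real.coe_toNNReal _ ht.le]
        nlinarith [K.coe_nonneg]
      by_contra hne
      have h4 : 0 < ‖x - y‖ := norm_pos_iff.2 (sub_ne_zero.2 hne)
      push_cast at h1
      nlinarith
    have hder : ∀ x ∈ B, HasFDerivWithinAt (fun x => x + t • g x)
        (1 + t • fderiv ℝ g x) B x := fun x hx =>
      ((hasFDerivAt_id x).add ((hgd x hx).hasFDerivAt.const_smul t)).hasFDerivWithinAt
    have key := integral_image_eq_integral_abs_det_fderiv_smul (volume : Measure E)
      measurableSet_closedBall hder hinj (fun _ => (1 : ℝ))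
    rw [himage] at key
    rw [show V = ∫ x in B, (1 : ℝ) by simp [V], key]
    refine setIntegral_congr_fun measurableSet_closedBall fun x hx => ?_
    have : 0 < (1 + t • fderiv ℝ g x).det := hdet _ <| by
      rw [norm_smul, Real.norm_of_nonneg ht.le]
      exact (mul_le_mul_of_nonneg_left (hK x hx) ht.le).trans_lt htε
    simp [abs_of_pos this]
  obtain ⟨δ, hδ, hδV⟩ : ∃ δ > 0, ∀ t ∈ Set.Ioo (0 : ℝ) δ,
      ∫ x in B, (1 + t • fderiv ℝ g x).det = V := by
    have hK0' : (0 : ℝ) < K := hK0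
    refine ⟨min 1 (min (ε / K) (1 / (2 * K))), by positivity, fun t ht => ?_⟩
    have h := ht.2
    simp only [lt_min_iff] at h
    refine hsmall t ht.1 h.1.le ((lt_div_iff₀ hK0').1 h.2.1) ?_
    have := (lt_div_iff₀ (by positivity)).1 h.2.2
    linarith
  obtain ⟨s, hsub, hcard⟩ := (Set.Ioo_infinite hδ).exists_subset_card_eq (Module.finrank ℝ E + 1)
  have hone : ∫ x in B, (1 + (1 : ℝ) • fderiv ℝ g x).det = V := by
    have hs : Module.finrank ℝ E < s.card := by omega
    simp_rw [fun x => det_one_add_smul_eq_sum_basis (fderiv ℝ g x) s hs 1]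
    rw [integral_finsetSum _ fun a _ => (hintegrable a).const_mul _]
    simp_rw [integral_const_mul]
    rw [Finset.sum_congr rfl fun a ha => by rw [hδV a (hsub ha)], ← Finset.sum_mul,
      ← Polynomial.eval_finsetSum, Lagrange.sum_basis Function.injective_id.injOn
        (Finset.card_pos.1 (by omega))]
    simp
  have hzero : ∫ x in B, (1 + (1 : ℝ) • fderiv ℝ g x).det = 0 := by
    refine setIntegral_eq_zero_of_forall_eq_zero fun x hx => ?_
    have hrd : HasFDerivAt r (1 + (1 : ℝ) • fderiv ℝ g x) x := by
      have := (hasFDerivAt_id x).add (hgd x hx).hasFDerivAt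
      rw [one_smul]
      refine this.congr_of_eventuallyEq (Eventually.of_forall fun y => ?_)
      simp [g]
    by_contra hne
    have hrx : ‖r x‖ = 1 := (hr1 x hx).self_of_nhds
    generalize (1 + (1 : ℝ) • fderiv ℝ g x : E →L[ℝ] E) = L at hrd hne
    have hu : IsUnit (L : E →ₗ[ℝ] E) :=
      (LinearMap.isUnit_iff_isUnit_det _).2 (isUnit_iff_ne_zero.2 hne)
    obtain ⟨v, hv⟩ := ((Module.End.isUnit_iff _).1 hu).2 (r x)
    have h1 := hrd.norm_sq
    have h2 : HasFDerivAt (fun y => ‖r y‖ ^ 2) (0 : E →L[ℝ] ℝ) x :=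
      (hasFDerivAt_const (1 : ℝ) x).congr_of_eventuallyEq <| by
        filter_upwards [hr1 x hx] with y hy
        simp [hy]
    have h3 := congrArg (fun f : E →L[ℝ] ℝ => f v) (h1.unique h2)
    have hv' : L v = r x := hv
    simp [hv', hrx] at h3
  have hV : 0 < V := ENNReal.toReal_pos (measure_closedBall_pos _ _ one_pos).ne'
    measure_closedBall_lt_top.ne
  linarith

open scoped InnerProductSpace in
/-- A `C¹` map sending the closed unit ball into the open unit ball has a fixed point. -/
theorem exists_fixedPoint_of_contDiff (F : E → E) (hF : ContDiff ℝ 1 F)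
    (hF1 : ∀ x ∈ closedBall (0 : E) 1, ‖F x‖ < 1) :
    ∃ x ∈ closedBall (0 : E) 1, F x = x := by
  by_contra! hne
  let u : E → E := fun x => x - F x
  have hu : ContDiff ℝ 1 u := contDiff_id.sub hF
  have hu0 : ∀ x ∈ closedBall (0 : E) 1, u x ≠ 0 := fun x hx h =>
    hne x hx (sub_eq_zero.1 h).symm
  let d : E → ℝ := fun x => ⟪x, u x⟫_ℝ ^ 2 + ‖u x‖ ^ 2 * (1 - ‖x‖ ^ 2)
  have hd : ContDiff ℝ 1 d :=
    ((contDiff_id.inner ℝ hu).pow 2).add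
      ((hu.norm_sq ℝ).mul (contDiff_const.sub (contDiff_id.norm_sq ℝ)))
  have hin : ∀ x : E, ‖x‖ = 1 → 0 < ⟪x, u x⟫_ℝ := by
    intro x hx
    have h1 : ⟪x, u x⟫_ℝ = 1 - ⟪x, F x⟫_ℝ := by
      simp [u, inner_sub_right, hx]
    have h2 := real_inner_le_norm x (F x)
    have h3 := hF1 x (by simp [hx])
    rw [hx, one_mul] at h2
    linarith
  have hd0 : ∀ x ∈ closedBall (0 : E) 1, 0 < d x := by
    intro x hx
    have hx1 : ‖x‖ ≤ 1 := by simpa using hx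
    have hup : 0 < ‖u x‖ ^ 2 := pow_pos (norm_pos_iff.2 (hu0 x hx)) 2
    rcases hx1.lt_or_eq with h | h
    · have : 0 < 1 - ‖x‖ ^ 2 := by nlinarith [norm_nonneg x]
      have := mul_pos hup this
      simp only [d]
      positivity
    · have := pow_pos (hin x h) 2
      simpa [d, h] using this
  let c : E → ℝ := fun x => (-⟪x, u x⟫_ℝ + √(d x)) / ‖u x‖ ^ 2
  refine not_exists_contDiff_retraction_sphere (fun x => x + c x • u x) (fun x hx => ?_)
    (fun x hx => ?_) fun x hx => ?_
  · have hc : ContDiffAt ℝ 1 c x :=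
      (((contDiff_id.inner ℝ hu).neg.contDiffAt).add
        (hd.contDiffAt.sqrt (hd0 x hx).ne')).div (hu.norm_sq ℝ).contDiffAt
        (pow_ne_zero 2 (norm_ne_zero_iff.2 (hu0 x hx)))
    exact contDiffAt_id.add (hc.smul hu.contDiffAt)
  · filter_upwards [hd.continuous.continuousAt.eventually (lt_mem_nhds (hd0 x hx)),
      hu.continuous.continuousAt.eventually_ne (hu0 x hx)] with y hdy huy
    have hup : ‖u y‖ ^ 2 ≠ 0 := pow_ne_zero 2 (norm_ne_zero_iff.2 huy)
    have hsq : √(d y) ^ 2 = ⟪y, u y⟫_ℝ ^ 2 + ‖u y‖ ^ 2 * (1 - ‖y‖ ^ 2) := Real.sq_sqrt hdy.le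
    have hc : c y * ‖u y‖ ^ 2 + ⟪y, u y⟫_ℝ = √(d y) := by
      simp only [c]
      field_simp
      ring
    have h1 : ‖y + c y • u y‖ ^ 2 = 1 := by
      rw [norm_add_sq_real, norm_smul, inner_smul_right, mul_pow, Real.norm_eq_abs, sq_abs]
      rw [← hc] at hsq
      refine mul_left_cancel₀ hup ?_
      linear_combination hsq
    exact (sq_eq_sq₀ (norm_nonneg _) zero_le_one).1 (by rw [h1, one_pow])
  · have : √(d x) = ⟪x, u x⟫_ℝ := by
      simp [d, hx, Real.sqrt_sq (hin x hx).le]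
    simp [c, this]

/-- **Brouwer fixed point theorem** for a continuous self-map with values in the unit ball. -/
theorem exists_fixedPoint_of_norm_le_one (T : E → E) (hT : Continuous T)
    (hT1 : ∀ x, ‖T x‖ ≤ 1) : ∃ x, T x = x := by
  by_contra! hne
  have hpos : ∀ x ∈ closedBall (0 : E) 1, 0 < ‖T x - x‖ := fun x _ =>
    norm_pos_iff.2 (sub_ne_zero.2 (hne x))
  obtain ⟨δ, hδ, hδT⟩ : ∃ δ > 0, ∀ x ∈ closedBall (0 : E) 1, δ ≤ ‖T x - x‖ :=
    (isCompact_closedBall (0 : E) 1).exists_forall_le' (by fun_prop) hpos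
  let η : ℝ := min (δ / 2) (1 / 2)
  have hη : 0 < η := by positivity
  have hη1 : η ≤ 1 / 2 := min_le_right _ _
  have hηδ : η ≤ δ / 2 := min_le_left _ _
  obtain ⟨F, hF, hFT, -⟩ := Continuous.exists_contDiff_approx (f := fun x => (1 - η) • T x)
    (ε := fun _ => η) 1 (by fun_prop) (by fun_prop) fun _ => hη
  simp only [dist_eq_norm] at hFT
  have hTη : ∀ x, ‖(1 - η) • T x‖ ≤ 1 - η := fun x => by
    rw [norm_smul, Real.norm_of_nonneg (by linarith)]
    nlinarith [hT1 x]
  obtain ⟨x, hx, hFx⟩ := exists_fixedPoint_of_contDiff F (by exact_mod_cast hF) fun x _ => by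
    have := norm_le_norm_add_norm_sub' (F x) ((1 - η) • T x)
    linarith [hFT x, hTη x]
  have h1 : ‖T x - (1 - η) • T x‖ ≤ η := by
    rw [show T x - (1 - η) • T x = η • T x by rw [sub_smul, one_smul]; abel, norm_smul,
      Real.norm_of_nonneg hη.le]
    nlinarith [hT1 x]
  have h2 := hFT x
  rw [hFx, norm_sub_rev] at h2
  have h3 := norm_sub_le_norm_sub_add_norm_sub (T x) ((1 - η) • T x) x
  linarith [hδT x hx]

open scoped InnerProductSpace in
/-- If the `e`-component of a continuous vector field is positive outside the open ball of radius
`R`, then the field points radially inwards somewhere on the sphere of radius `R`. -/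
theorem exists_eq_neg_smul_of_inner_pos (f : E → E) (hf : Continuous f) (e : E) (he : ‖e‖ = 1)
    {R : ℝ} (hR : 0 < R) (hpos : ∀ y, R ≤ ‖y‖ → 0 < ⟪e, f y⟫_ℝ) :
    ∃ y, ‖y‖ = R ∧ ∃ γ > (0 : ℝ), f y = -γ • y := by
  let ρ : E → E := fun x => x - (⟪e, x⟫_ℝ + √(1 - ‖x‖ ^ 2 + ⟪e, x⟫_ℝ ^ 2)) • e
  have hρ : Continuous ρ := by fun_prop
  have hρ1 : ∀ x, 1 ≤ ‖ρ x‖ := by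
    intro x
    have hs : 1 - ‖x‖ ^ 2 + ⟪e, x⟫_ℝ ^ 2 ≤ √(1 - ‖x‖ ^ 2 + ⟪e, x⟫_ℝ ^ 2) ^ 2 :=
      (le_max_left _ _).trans_eq Real.sq_sqrt'.symm
    have h : ‖ρ x‖ ^ 2 = ‖x‖ ^ 2 - ⟪e, x⟫_ℝ ^ 2 + √(1 - ‖x‖ ^ 2 + ⟪e, x⟫_ℝ ^ 2) ^ 2 := by
      simp only [ρ]
      rw [norm_sub_sq_real, norm_smul, inner_smul_right, mul_pow, he, Real.norm_eq_abs, sq_abs,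
        real_inner_comm]
      ring
    exact (one_le_sq_iff₀ (norm_nonneg _)).1 (by linarith)
  have hin : ∀ x, 0 < ⟪e, f (R • ρ x)⟫_ℝ := fun x => hpos _ <| by
    rw [norm_smul, Real.norm_of_nonneg hR.le]
    nlinarith [hρ1 x]
  have hf0 : ∀ x, ‖f (R • ρ x)‖ ≠ 0 := fun x h => by
    have := hin x
    rw [norm_eq_zero.1 h, inner_zero_right] at this
    exact this.false
  obtain ⟨x, hx⟩ := exists_fixedPoint_of_norm_le_one
    (fun x => -(‖f (R • ρ x)‖⁻¹ • f (R • ρ x)))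
    (((hf.comp (hρ.const_smul R)).norm.inv₀ hf0).smul (hf.comp (hρ.const_smul R))).neg
    (fun x => by simp [norm_smul, hf0 x])
  have hfp : 0 < ‖f (R • ρ x)‖ := (norm_nonneg _).lt_of_ne' (hf0 x)
  have hx1 : ‖x‖ = 1 := by
    rw [← hx, norm_neg, norm_smul, norm_inv, norm_norm, inv_mul_cancel₀ (hf0 x)]
  have hw : ⟪e, x⟫_ℝ < 0 := by
    have h : ⟪e, x⟫_ℝ = -(‖f (R • ρ x)‖⁻¹ * ⟪e, f (R • ρ x)⟫_ℝ) := by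
      conv_lhs => rw [← hx, inner_neg_right, inner_smul_right]
    rw [h]
    have := mul_pos (inv_pos.2 hfp) (hin x)
    linarith
  have hρx : ρ x = x := by
    have : √(⟪e, x⟫_ℝ ^ 2) = -⟪e, x⟫_ℝ := by
      rw [Real.sqrt_sq_eq_abs, abs_of_neg hw]
    simp [ρ, hx1, this]
  rw [hρx] at hx hfp
  refine ⟨R • x, by rw [norm_smul, hx1, mul_one, Real.norm_of_nonneg hR.le],
    ‖f (R • x)‖ / R, by positivity, ?_⟩
  have h : f (R • x) = -(‖f (R • x)‖ • x) := by
    conv_rhs => enter [1, 2]; rw [← hx]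
    rw [smul_neg, neg_neg, smul_inv_smul₀ hfp.ne']
  rw [smul_smul, neg_mul, div_mul_cancel₀ _ hR.ne', neg_smul]
  exact h

end Brouwer

theorem stmt_17 {n m : ℕ} (hmn : m + 2 ≤ n)
    (A : Fin m → Matrix (Fin n) (Fin n) ℝ) (hA : ∀ i, (A i).IsSymm)
    (μ : ℝ) (hμ : 0 < μ)
    (xs : Fin n → ℝ) (hxs : xs ⬝ᵥ xs = 1)
    (hG : ¬ (|(∑ i, |xs ⬝ᵥ (A i) *ᵥ xs|) - μ| - ((∑ i, |xs ⬝ᵥ (A i) *ᵥ xs|) - μ) = 0 ∧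
        xs ⬝ᵥ xs - 1 = 0)) :
    ∃ x : ℕ → (Fin n → ℝ),
      Tendsto (fun k => Real.sqrt (x k ⬝ᵥ x k)) atTop atTop ∧
      ∀ k, ∃ γ : ℝ, 0 < γ ∧
        (∀ i : Fin m,
          x k ⬝ᵥ (A i) *ᵥ x k - xs ⬝ᵥ (A i) *ᵥ xs
            = -γ * x k (Fin.castLE (by omega) i)) ∧
        |(∑ i, |x k ⬝ᵥ (A i) *ᵥ x k|) - μ| - ((∑ i, |x k ⬝ᵥ (A i) *ᵥ x k|) - μ)
            = -γ * x k ⟨n - 2, by omega⟩ ∧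
        (x k - xs) ⬝ᵥ (x k - xs) = -γ * x k ⟨n - 1, by omega⟩ := by
  let f : EuclideanSpace ℝ (Fin n) → EuclideanSpace ℝ (Fin n) := fun y =>
    WithLp.toLp 2 fun j =>
      if h : j.val < m then y.ofLp ⬝ᵥ (A ⟨j, h⟩) *ᵥ y.ofLp - xs ⬝ᵥ (A ⟨j, h⟩) *ᵥ xs
      else if j.val = n - 1 then (y.ofLp - xs) ⬝ᵥ (y.ofLp - xs)
      else |(∑ i, |y.ofLp ⬝ᵥ (A i) *ᵥ y.ofLp|) - μ| - ((∑ i, |y.ofLp ⬝ᵥ (A i) *ᵥ y.ofLp|) - μ)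
  have hf : Continuous f := by
    refine (PiLp.continuous_toLp 2 _).comp (continuous_pi fun j => ?_)
    split_ifs <;> fun_prop
  have hnorm : ∀ y : EuclideanSpace ℝ (Fin n), Real.sqrt (y.ofLp ⬝ᵥ y.ofLp) = ‖y‖ := fun y => by
    simp [EuclideanSpace.norm_eq, dotProduct, sq]
  let l : Fin n := ⟨n - 1, by omega⟩
  have hlast : ∀ y, f y l = (y.ofLp - xs) ⬝ᵥ (y.ofLp - xs) := fun y => by
    have : ¬ n - 1 < m := by omega
    simp [f, l, this]
  have key : ∀ k : ℕ, ∃ y : EuclideanSpace ℝ (Fin n), ‖y‖ = k + 2 ∧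
      ∃ γ > (0 : ℝ), f y = -γ • y := fun k => by
    refine exists_eq_neg_smul_of_inner_pos f hf (EuclideanSpace.single l 1) (by simp)
      (by positivity) fun y hy => ?_
    have hne : y.ofLp - xs ≠ 0 := fun h => by
      have := hnorm y
      rw [sub_eq_zero.1 h, hxs, Real.sqrt_one] at this
      have hk : (0 : ℝ) ≤ k := k.cast_nonneg
      linarith
    have hp : 0 < (y.ofLp - xs) ⬝ᵥ (y.ofLp - xs) :=
      (Finset.sum_nonneg fun i _ => mul_self_nonneg _).lt_of_ne'
        (mt dotProduct_self_eq_zero.1 hne)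
    simpa [EuclideanSpace.inner_single_left, hlast] using hp
  choose x hx γ hγ hfx using key
  have hcoord : ∀ k j, f (x k) j = -γ k * x k j := fun k j => by
    rw [hfx]; simp
  refine ⟨fun k => (x k).ofLp, ?_, fun k => ⟨γ k, hγ k, fun i => ?_, ?_, ?_⟩⟩
  · simp only [hnorm, hx]
    exact tendsto_atTop_add_const_right _ _ tendsto_natCast_atTop_atTop
  · rw [← hcoord]
    simp [f]
  · have h1 : ¬ n - 2 < m := by omega
    have h2 : n - 2 ≠ n - 1 := by omega
    rw [← hcoord]
    simp [f, h1, h2]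
  · rw [← hcoord]
    exact (hlast (x k)).symm
end

section
/- Let m ≤ n − 2 and let A_1,…,A_m be real symmetric n×n matrices. Let μ > 0 be a given constant and suppose there exists x* ∈ ℝⁿ with ‖x*‖ = 1 such that G_μ(x*) ≠ 0 (equivalently, ∑_{i=1}^m |(x*)ᵀ A_i x*| < μ). Then there exists a vector x̂ ∈ ℝⁿ with ‖x̂‖ = 1, x̂_{n−1} = 0, x̂_n ∈ [−1, 0), and x̂ᵀ A_i x̂ = x̂_i / x̂_n for all i = 1,…,m. -/
open Matrix

/-- `det (1 + s • A)` is a polynomial in `s` of degree at most the dimension. -/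
lemma LinearMap.exists_polynomial_eval_eq_det_one_add_smul {E : Type*} [AddCommGroup E]
    [Module ℝ E] [FiniteDimensional ℝ E] (A : E →ₗ[ℝ] E) :
    ∃ p : Polynomial ℝ, p.natDegree ≤ Module.finrank ℝ E ∧
      ∀ s : ℝ, p.eval s = LinearMap.det (1 + s • A) := by
  let b := Module.finBasis ℝ E
  let M := LinearMap.toMatrix b b A
  refine ⟨det ((Polynomial.X : Polynomial ℝ) • M.map Polynomial.C +
    (1 : Matrix _ _ ℝ).map Polynomial.C), ?_, fun s => ?_⟩
  · simpa using Polynomial.natDegree_det_X_add_C_le M 1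
  · rw [← LinearMap.det_toMatrix b, ← Polynomial.coe_evalRingHom, RingHom.map_det]
    congr 1
    ext i j
    by_cases hij : i = j <;> simp [M, hij, LinearMap.toMatrix_one] <;> ring

/-- A small Lipschitz perturbation of the identity has nonvanishing differential,
hence positive Jacobian. -/
lemma LinearMap.det_one_add_smul_pos {E : Type*} [NormedAddCommGroup E] [NormedSpace ℝ E]
    [FiniteDimensional ℝ E] (A : E →L[ℝ] E) {L s : ℝ} (hA : ‖A‖ ≤ L) (hs : 0 ≤ s)
    (hsL : s * L < 1) : 0 < LinearMap.det (1 + s • (A : E →ₗ[ℝ] E)) := by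
  obtain ⟨p, -, hp⟩ := LinearMap.exists_polynomial_eval_eq_det_one_add_smul (A : E →ₗ[ℝ] E)
  have hL : 0 ≤ L := (norm_nonneg A).trans hA
  have hne : ∀ u ∈ Set.Icc 0 s, p.eval u ≠ 0 := by
    intro u hu h0
    rw [hp] at h0
    obtain ⟨v, hv, hv0⟩ := (Submodule.ne_bot_iff _).1
      (LinearMap.bot_lt_ker_of_det_eq_zero h0).ne'
    have hv' : v = -(u • A v) := by
      have : v + u • A v = 0 := by simpa using hv
      exact eq_neg_of_add_eq_zero_left this
    have h1 : ‖v‖ ≤ u * (L * ‖v‖) := by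
      calc ‖v‖ = u * ‖A v‖ := by
            conv_lhs => rw [hv', norm_neg, norm_smul, Real.norm_of_nonneg hu.1]
        _ ≤ u * (L * ‖v‖) :=
            mul_le_mul_of_nonneg_left (A.le_of_opNorm_le hA v) hu.1
    have h2 : 0 < ‖v‖ := norm_pos_iff.2 hv0
    have h3 : u * L ≤ s * L := mul_le_mul_of_nonneg_right hu.2 hL
    nlinarith
  rw [← hp]
  by_contra! hneg
  obtain ⟨u, hu, hu0⟩ := intermediate_value_Icc' hs p.continuous.continuousOn
    (show (0 : ℝ) ∈ Set.Icc (p.eval s) (p.eval 0) from ⟨hneg, by simp [hp]⟩)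
  exact hne u hu hu0

open MeasureTheory Metric in
/-- If `g` is Lipschitz and vanishes outside a ball, then `x ↦ x + s • g x` maps the ball
bijectively onto itself for small `s`, so its Jacobian integrates to the volume. -/
lemma integral_ball_det_one_add_smul_fderiv {E : Type*} [NormedAddCommGroup E]
    [InnerProductSpace ℝ E] [FiniteDimensional ℝ E] [MeasurableSpace E] [BorelSpace E]
    {g : E → E} {g' : E → E →L[ℝ] E} {L : NNReal} {R s : ℝ} (hg : LipschitzWith L g)
    (hg0 : ∀ x ∉ ball (0 : E) R, g x = 0) (hg' : ∀ x ∈ ball (0 : E) R, HasFDerivAt g (g' x) x)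
    (hs : 0 ≤ s) (hsL : s * L < 1) :
    IntegrableOn (fun x => LinearMap.det (1 + s • (g' x : E →ₗ[ℝ] E))) (ball 0 R) ∧
    ∫ x in ball (0 : E) R, LinearMap.det (1 + s • (g' x : E →ₗ[ℝ] E)) =
      volume.real (ball (0 : E) R) := by
  set f : E → E := fun x => x + s • g x with hf
  have hinj : Function.Injective f := by
    intro x y hxy
    have h1 : x - y = s • (g y - g x) := by
      simp only [hf] at hxy
      rw [smul_sub, sub_eq_sub_iff_add_eq_add, hxy, add_comm]
    have h2 : ‖x - y‖ ≤ s * (L * ‖x - y‖) := by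
      calc ‖x - y‖ = s * ‖g y - g x‖ := by
            rw [h1, norm_smul, Real.norm_of_nonneg hs]
        _ ≤ s * (L * ‖x - y‖) := by
            rw [norm_sub_rev x y]
            exact mul_le_mul_of_nonneg_left (hg.norm_sub_le y x) hs
    have h3 : ‖x - y‖ = 0 := by nlinarith [norm_nonneg (x - y)]
    exact sub_eq_zero.1 (norm_eq_zero.1 h3)
  have hsurj : Function.Surjective f := by
    intro y
    have hK : ContractingWith (s.toNNReal * L) (fun x => y - s • g x) := by
      refine ⟨?_, LipschitzWith.of_dist_le_mul fun a b => ?_⟩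
      · rw [← NNReal.coe_lt_coe, NNReal.coe_mul, Real.coe_toNNReal s hs]
        exact hsL
      have h := hg.norm_sub_le b a
      rw [dist_eq_norm, dist_eq_norm, sub_sub_sub_cancel_left, ← smul_sub, norm_smul,
        Real.norm_of_nonneg hs, norm_sub_rev a b, NNReal.coe_mul,
        Real.coe_toNNReal s hs, mul_assoc]
      exact mul_le_mul_of_nonneg_left h hs
    refine ⟨hK.fixedPoint, ?_⟩
    have h : y - s • g hK.fixedPoint = hK.fixedPoint := hK.fixedPoint_isFixedPt
    simp only [hf]
    nth_rewrite 1 [← h]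
    abel
  have hout : ∀ x ∉ ball (0 : E) R, f x = x := fun x hx => by simp [hf, hg0 x hx]
  have himage : f '' ball 0 R = ball 0 R := by
    ext y
    constructor
    · rintro ⟨x, hx, rfl⟩
      by_contra h
      rw [hinj (hout _ h)] at h
      exact h hx
    · intro hy
      obtain ⟨x, rfl⟩ := hsurj y
      refine ⟨x, ?_, rfl⟩
      by_contra h
      rw [hout x h] at hy
      exact h hy
  have hder : ∀ x ∈ ball (0 : E) R,
      HasFDerivWithinAt f (ContinuousLinearMap.id ℝ E + s • g' x) (ball 0 R) x := fun x hx =>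
    ((hasFDerivAt_id x).add ((hg' x hx).const_smul s)).hasFDerivWithinAt
  have hdet : Set.EqOn (fun x => |(ContinuousLinearMap.id ℝ E + s • g' x).det| • (1 : ℝ))
      (fun x => LinearMap.det (1 + s • (g' x : E →ₗ[ℝ] E))) (ball 0 R) := fun x hx => by
    have hpos := LinearMap.det_one_add_smul_pos (g' x) ((hg' x hx).le_of_lipschitz hg) hs hsL
    exact (mul_one _).trans (abs_of_pos hpos)
  constructor
  · have key := (integrableOn_image_iff_integrableOn_abs_det_fderiv_smul volume
      measurableSet_ball hder hinj.injOn (fun _ => (1 : ℝ))).1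
    rw [himage] at key
    exact (key (integrableOn_const measure_ball_lt_top.ne)).congr_fun hdet measurableSet_ball
  · have key := integral_image_eq_integral_abs_det_fderiv_smul volume measurableSet_ball hder
      hinj.injOn (fun _ => (1 : ℝ))
    rw [himage, setIntegral_congr_fun measurableSet_ball hdet] at key
    simp [← key]

/-- Integrated polynomial identity: the Jacobian of `id + g` integrates to the volume even when
`g` is not small. -/
lemma integral_ball_det_one_add_fderiv {E : Type*} [NormedAddCommGroup E]
    [InnerProductSpace ℝ E] [FiniteDimensional ℝ E] [MeasurableSpace E] [BorelSpace E]
    {g : E → E} {g' : E → E →L[ℝ] E} {L : NNReal} {R : ℝ} (hg : LipschitzWith L g)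
    (hg0 : ∀ x ∉ Metric.ball (0 : E) R, g x = 0)
    (hg' : ∀ x ∈ Metric.ball (0 : E) R, HasFDerivAt g (g' x) x) :
    ∫ x in Metric.ball (0 : E) R, LinearMap.det (1 + (g' x : E →ₗ[ℝ] E)) =
      MeasureTheory.volume.real (Metric.ball (0 : E) R) := by
  choose p hdeg hp using fun x =>
    LinearMap.exists_polynomial_eval_eq_det_one_add_smul (g' x : E →ₗ[ℝ] E)
  set d := Module.finrank ℝ E
  let v : ℕ → ℝ := fun j => 1 / ((L + 1) * (j + 1))
  have hvpos : ∀ j, 0 < v j := fun j => by positivity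
  have hvL : ∀ j, v j * L < 1 := fun j => by
    simp only [v]
    rw [one_div_mul_eq_div, div_lt_one (by positivity)]
    nlinarith [L.coe_nonneg, mul_nonneg L.coe_nonneg (Nat.cast_nonneg (α := ℝ) j),
      Nat.cast_nonneg (α := ℝ) j]
  have hvinj : Set.InjOn v (Finset.range (d + 1)) := fun i _ j _ hij => by
    simp only [v] at hij
    rw [one_div, one_div, _root_.inv_inj] at hij
    have := mul_left_cancel₀ (by positivity) hij
    exact_mod_cast add_right_cancel this
  have hinterp : ∀ q : Polynomial ℝ, q.natDegree ≤ d →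
      q.eval 1 = ∑ j ∈ Finset.range (d + 1),
        q.eval (v j) * (Lagrange.basis (Finset.range (d + 1)) v j).eval 1 := by
    intro q hq
    have hq' : q.degree < (Finset.range (d + 1)).card := by
      rw [Finset.card_range]
      exact Polynomial.degree_lt_iff_coeff_zero _ _ |>.2 fun m hm =>
        Polynomial.coeff_eq_zero_of_natDegree_lt (by omega)
    conv_lhs => rw [Lagrange.eq_interpolate hvinj hq']
    simp [Lagrange.interpolate_apply, Polynomial.eval_finsetSum]
  have hsmall := fun j => integral_ball_det_one_add_smul_fderiv hg hg0 hg' (hvpos j).le (hvL j)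
  have h1 : ∀ x, LinearMap.det (1 + (g' x : E →ₗ[ℝ] E)) = ∑ j ∈ Finset.range (d + 1),
      LinearMap.det (1 + v j • (g' x : E →ₗ[ℝ] E)) *
        (Lagrange.basis (Finset.range (d + 1)) v j).eval 1 := fun x => by
    have := hinterp (p x) (hdeg x)
    simpa [hp] using this
  simp_rw [h1]
  rw [MeasureTheory.integral_finsetSum _ fun j _ => (hsmall j).1.mul_const _]
  simp_rw [MeasureTheory.integral_mul_const, (hsmall _).2]
  rw [← Finset.mul_sum]
  have h2 := hinterp 1 (by simp)
  simp only [Polynomial.eval_one, one_mul] at h2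
  rw [← h2, mul_one]

open Metric in
/-- A map that is Lipschitz on a closed ball and vanishes on its boundary stays Lipschitz when
extended by zero. -/
lemma LipschitzOnWith.lipschitzWith_ite_mem_ball {E F : Type*} [NormedAddCommGroup E]
    [NormedSpace ℝ E] [NormedAddCommGroup F] {g : E → F} {L : NNReal} {R : ℝ}
    [DecidablePred (· ∈ ball (0 : E) R)]
    (hg : LipschitzOnWith L g (closedBall 0 R)) (hg0 : ∀ x ∈ sphere (0 : E) R, g x = 0) :
    LipschitzWith L (fun x => if x ∈ ball (0 : E) R then g x else 0) := by
  have cross : ∀ x ∈ ball (0 : E) R, ∀ y ∉ ball (0 : E) R, ‖g x‖ ≤ L * dist x y := by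
    intro x hx y hy
    rw [mem_ball_zero_iff] at hx hy
    have hc : ContinuousOn (fun t : ℝ => ‖x + t • (y - x)‖) (Set.Icc 0 1) := by fun_prop
    obtain ⟨t, ht, htR⟩ := intermediate_value_Icc zero_le_one hc
      (show R ∈ Set.Icc _ _ by simpa using ⟨hx.le, not_lt.1 hy⟩)
    have hp := hg.dist_le_mul x (by simpa using hx.le) (x + t • (y - x)) (by simpa using htR.le)
    rw [hg0 (x + t • (y - x)) (by simpa using htR), dist_zero_right] at hp
    refine hp.trans (mul_le_mul_of_nonneg_left ?_ L.coe_nonneg)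
    rw [dist_self_add_right, norm_smul, Real.norm_of_nonneg ht.1, dist_eq_norm, norm_sub_rev x y]
    exact mul_le_of_le_one_left (norm_nonneg _) ht.2
  refine LipschitzWith.of_dist_le_mul fun x y => ?_
  by_cases hx : x ∈ ball (0 : E) R <;> by_cases hy : y ∈ ball (0 : E) R <;>
    simp only [hx, hy, if_true, if_false]
  · exact hg.dist_le_mul x (ball_subset_closedBall hx) y (ball_subset_closedBall hy)
  · simpa using cross x hx y hy
  · simpa [dist_comm] using cross y hy x hx
  · simp; positivity

/-- A map of constant nonzero norm has singular differential. -/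
lemma HasFDerivAt.det_eq_zero_of_norm_const {E : Type*} [NormedAddCommGroup E]
    [InnerProductSpace ℝ E] [FiniteDimensional ℝ E] {r : E → E} {r' : E →L[ℝ] E} {x : E} {R : ℝ}
    (hR : R ≠ 0) (hr : HasFDerivAt r r' x) (hnorm : ∀ y, ‖r y‖ = R) :
    LinearMap.det (r' : E →ₗ[ℝ] E) = 0 := by
  by_contra h
  have hsurj : Function.Surjective r' :=
    (LinearMap.equivOfDetNeZero (r' : E →ₗ[ℝ] E) h).surjective
  obtain ⟨v, hv⟩ := hsurj (r x)
  have h1 := hr.norm_sq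
  simp only [hnorm] at h1
  have h2 := congrArg (fun φ => φ v) (h1.unique (hasFDerivAt_const (R ^ 2) x))
  have h3 : R = 0 := by simpa [hv, hnorm] using h2
  exact hR h3

open Metric in
/-- No-retraction theorem for a ball, for smooth maps. -/
lemma not_forall_norm_eq_of_eq_on_sphere {E : Type*} [NormedAddCommGroup E]
    [InnerProductSpace ℝ E] [FiniteDimensional ℝ E] {r : E → E} {R : ℝ} (hR : 0 < R)
    (hr : ContDiff ℝ 1 r) (hsphere : ∀ x ∈ sphere (0 : E) R, r x = x) :
    ¬ ∀ x, ‖r x‖ = R := by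
  classical
  intro hnorm
  borelize E
  have hg0 : ContDiff ℝ 1 (fun x => r x - x) := hr.sub contDiff_id
  obtain ⟨L, hL⟩ := hg0.contDiffOn.exists_lipschitzOnWith one_ne_zero
    (convex_closedBall (0 : E) R) (isCompact_closedBall 0 R)
  have hLip := hL.lipschitzWith_ite_mem_ball fun x hx => by simp [hsphere x hx]
  have hder : ∀ x ∈ ball (0 : E) R, HasFDerivAt
      (fun x => if x ∈ ball (0 : E) R then r x - x else 0)
      (fderiv ℝ r x - ContinuousLinearMap.id ℝ E) x := fun x hx =>
    (((hr.differentiable one_ne_zero x).hasFDerivAt).sub (hasFDerivAt_id x)).congr_of_eventuallyEq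
      (Filter.eventuallyEq_of_mem (isOpen_ball.mem_nhds hx) fun y hy => if_pos hy)
  have key := integral_ball_det_one_add_fderiv hLip (fun x hx => if_neg hx) hder
  have hzero : ∀ x, LinearMap.det
      (1 + ((fderiv ℝ r x - ContinuousLinearMap.id ℝ E : E →L[ℝ] E) : E →ₗ[ℝ] E)) = 0 := by
    intro x
    rw [← (hr.differentiable one_ne_zero x).hasFDerivAt.det_eq_zero_of_norm_const hR.ne' hnorm]
    congr 1
    ext v
    simp
  simp only [hzero, MeasureTheory.integral_zero] at key
  have hpos : 0 < MeasureTheory.volume (ball (0 : E) R) := measure_ball_pos _ _ hR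
  exact (ENNReal.toReal_pos hpos.ne' MeasureTheory.measure_ball_lt_top.ne).ne key

/-- A bounded `C¹` self-map of a Euclidean space has a fixed point. -/
theorem exists_fixedPoint_of_contDiff_of_norm_le {E : Type*} [NormedAddCommGroup E]
    [InnerProductSpace ℝ E] [FiniteDimensional ℝ E] {P : E → E} {C : ℝ}
    (hP : ContDiff ℝ 1 P) (hC : ∀ x, ‖P x‖ ≤ C) : ∃ x, P x = x := by
  by_contra! hne
  have hC0 : 0 ≤ C := (norm_nonneg _).trans (hC 0)
  let χ : ContDiffBump (0 : E) := ⟨C + 1, C + 2, by linarith, by linarith⟩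
  let w : E → E := fun x => x - χ x • P x
  have hw : ContDiff ℝ 1 w := contDiff_id.sub (χ.contDiff.smul hP)
  have hw0 : ∀ x, w x ≠ 0 := by
    intro x h
    have hx : x = χ x • P x := sub_eq_zero.1 h
    rcases le_or_gt ‖x‖ (C + 1) with h1 | h1
    · rw [χ.one_of_mem_closedBall (by simpa using h1), one_smul] at hx
      exact hne x hx.symm
    · have h2 : ‖x‖ ≤ C := by
        calc ‖x‖ = χ x * ‖P x‖ := by
              conv_lhs => rw [hx, norm_smul, Real.norm_of_nonneg χ.nonneg]
          _ ≤ 1 * C := mul_le_mul χ.le_one (hC x) (norm_nonneg _) zero_le_one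
          _ = C := one_mul C
      linarith
  refine not_forall_norm_eq_of_eq_on_sphere (r := fun x => ((C + 2) / ‖w x‖) • w x)
    (by linarith : 0 < C + 2) ?_ ?_ ?_
  · exact (contDiff_const.div (hw.norm ℝ hw0) fun x => norm_ne_zero_iff.2 (hw0 x)).smul hw
  · intro x hx
    have hxR : ‖x‖ = C + 2 := by simpa using hx
    have hwx : w x = x := by
      simp only [w]
      rw [χ.zero_of_le_dist (by simpa using hxR.ge), zero_smul, sub_zero]
    simp only [hwx, hxR]
    rw [div_self (by linarith), one_smul]
  · intro x
    have h := norm_ne_zero_iff.2 (hw0 x)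
    rw [norm_smul, norm_div, norm_norm, div_mul_cancel₀ _ h, Real.norm_of_nonneg (by linarith)]

/-- A quadratic form is bounded by a multiple of the squared norm. -/
lemma Matrix.exists_abs_dotProduct_mulVec_le {ι : Type*} [Fintype ι] (A : Matrix ι ι ℝ) :
    ∃ K : ℝ, ∀ x : ι → ℝ, |x ⬝ᵥ A *ᵥ x| ≤ K * (x ⬝ᵥ x) := by
  refine ⟨∑ i, ∑ j, |A i j|, fun x => ?_⟩
  have hle : ∀ i, x i ^ 2 ≤ x ⬝ᵥ x := fun i => by
    rw [sq]
    exact Finset.single_le_sum (f := fun i => x i * x i) (fun j _ => mul_self_nonneg _)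
      (Finset.mem_univ i)
  have hterm : ∀ i j, |x i * (A i j * x j)| ≤ |A i j| * (x ⬝ᵥ x) := fun i j => by
    have h : |x i| * |x j| ≤ x ⬝ᵥ x := by
      nlinarith [hle i, hle j, sq_nonneg (|x i| - |x j|), sq_abs (x i), sq_abs (x j)]
    rw [abs_mul, abs_mul, mul_left_comm]
    exact mul_le_mul_of_nonneg_left h (abs_nonneg _)
  calc |x ⬝ᵥ A *ᵥ x| = |∑ i, ∑ j, x i * (A i j * x j)| := by
        simp only [dotProduct, mulVec, Finset.mul_sum]
    _ ≤ ∑ i, ∑ j, |x i * (A i j * x j)| :=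
        (Finset.abs_sum_le_sum_abs _ _).trans
          (Finset.sum_le_sum fun i _ => Finset.abs_sum_le_sum_abs _ _)
    _ ≤ ∑ i, ∑ j, |A i j| * (x ⬝ᵥ x) :=
        Finset.sum_le_sum fun i _ => Finset.sum_le_sum fun j _ => hterm i j
    _ = (∑ i, ∑ j, |A i j|) * (x ⬝ᵥ x) := by simp only [Finset.sum_mul]

theorem stmt_18 {n m : ℕ} (hmn : m + 2 ≤ n)
    (A : Fin m → Matrix (Fin n) (Fin n) ℝ) (hA : ∀ i, (A i).IsSymm)
    (μ : ℝ) (hμ : 0 < μ)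
    (xs : Fin n → ℝ) (hxs : xs ⬝ᵥ xs = 1)
    (hG : ¬ (|(∑ i, |xs ⬝ᵥ (A i) *ᵥ xs|) - μ| - ((∑ i, |xs ⬝ᵥ (A i) *ᵥ xs|) - μ) = 0 ∧
        xs ⬝ᵥ xs - 1 = 0)) :
    ∃ xh : Fin n → ℝ, xh ⬝ᵥ xh = 1 ∧ xh ⟨n - 2, by omega⟩ = 0 ∧
      xh ⟨n - 1, by omega⟩ ∈ Set.Ico (-1 : ℝ) 0 ∧
      ∀ i : Fin m,
        xh ⬝ᵥ (A i) *ᵥ xh = xh (Fin.castLE (by omega) i) / xh ⟨n - 1, by omega⟩ := by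
  clear hG hxs xs hμ μ hA
  let X : EuclideanSpace ℝ (Fin m) → Fin n → ℝ := fun z j =>
    if h : j.1 < m then z ⟨j, h⟩ else if j.1 = n - 1 then 1 else 0
  have hXz : ∀ z i, X z (Fin.castLE (by omega) i) = z i := fun z i => by simp [X]
  have hXlast : ∀ z, X z ⟨n - 1, by omega⟩ = 1 := fun z => by
    simp [X, show ¬ n - 1 < m by omega]
  have hXpre : ∀ z, X z ⟨n - 2, by omega⟩ = 0 := fun z => by
    simp [X, show ¬ n - 2 < m by omega, show ¬ n - 2 = n - 1 by omega]
  have hXX : ∀ z, X z ⬝ᵥ X z = 1 + ‖z‖ ^ 2 := by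
    intro z
    obtain ⟨k, rfl⟩ : ∃ k, n = m + (k + 1 + 1) := ⟨n - m - 2, by omega⟩
    rw [dotProduct, Fin.sum_univ_add, Fin.sum_univ_castSucc, EuclideanSpace.norm_sq_eq, add_comm]
    congr 1
    · have h : ∀ i : Fin (k + 1), i.1 ≠ k + 1 := fun i => by omega
      simp [X, h]
    · simp [X, sq]
  have hXcont : ∀ j, ContDiff ℝ 1 (fun z => X z j) := by
    intro j
    by_cases h : j.1 < m
    · simp only [X, h, dif_pos]
      fun_prop
    · simp only [X, h, dif_neg, not_false_eq_true]
      exact contDiff_const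
  have hpos : ∀ z : EuclideanSpace ℝ (Fin m), 0 < 1 + ‖z‖ ^ 2 := fun z => by positivity
  choose K hK using fun i => (A i).exists_abs_dotProduct_mulVec_le
  let P : EuclideanSpace ℝ (Fin m) → EuclideanSpace ℝ (Fin m) := fun z =>
    WithLp.toLp 2 fun i => (X z ⬝ᵥ A i *ᵥ X z) / (1 + ‖z‖ ^ 2)
  have hP : ContDiff ℝ 1 P := by
    refine contDiff_euclidean.2 fun i => ?_
    refine ContDiff.div ?_ (contDiff_const.add (contDiff_norm_sq ℝ)) fun z => (hpos z).ne'
    simp only [dotProduct, mulVec]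
    exact ContDiff.sum fun j _ => (hXcont j).mul <| ContDiff.sum fun l _ =>
      contDiff_const.mul (hXcont l)
  have hbound : ∀ z, ‖P z‖ ≤ √(∑ i, K i ^ 2) := by
    intro z
    refine Real.le_sqrt_of_sq_le ?_
    rw [EuclideanSpace.norm_sq_eq]
    refine Finset.sum_le_sum fun i _ => ?_
    refine pow_le_pow_left₀ (norm_nonneg _) ?_ 2
    have h := hK i (X z)
    rw [hXX] at h
    simp only [P, Real.norm_eq_abs, abs_div, abs_of_pos (hpos z)]
    exact (div_le_iff₀ (hpos z)).2 h
  obtain ⟨z, hz⟩ := exists_fixedPoint_of_contDiff_of_norm_le hP hbound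
  have hs : 0 < √(1 + ‖z‖ ^ 2) := Real.sqrt_pos.2 (hpos z)
  have hsq : (√(1 + ‖z‖ ^ 2))⁻¹ * (√(1 + ‖z‖ ^ 2))⁻¹ = (1 + ‖z‖ ^ 2)⁻¹ := by
    rw [← mul_inv, Real.mul_self_sqrt (hpos z).le]
  refine ⟨-(√(1 + ‖z‖ ^ 2))⁻¹ • X z, ?_, ?_, ?_, fun i => ?_⟩
  · rw [smul_dotProduct, dotProduct_smul, smul_smul, neg_mul_neg, hsq, hXX, smul_eq_mul,
      inv_mul_cancel₀ (hpos z).ne']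
  · simp [hXpre]
  · have h1 : (√(1 + ‖z‖ ^ 2))⁻¹ ≤ 1 :=
      inv_le_one_of_one_le₀ (Real.one_le_sqrt.2 (by nlinarith [sq_nonneg ‖z‖]))
    simpa [hXlast] using ⟨h1, hpos z⟩
  · have hzi : (X z ⬝ᵥ A i *ᵥ X z) / (1 + ‖z‖ ^ 2) = z i := congrArg (fun y => y i) hz
    rw [mulVec_smul, smul_dotProduct, dotProduct_smul, smul_smul, neg_mul_neg, hsq,
      Pi.smul_apply, Pi.smul_apply, hXz, hXlast, smul_eq_mul, smul_eq_mul, smul_eq_mul, mul_one,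
      mul_div_cancel_left₀ _ (neg_ne_zero.2 (inv_pos.2 hs).ne'), ← hzi, div_eq_inv_mul]
end
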